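/- Let U = {10η : η ∈ {0,1}^ℕ} be the cylinder of the sequence 10, and let RStab_Ŝ(U) = {g ∈ Ŝ : ξ·g = ξ for all ξ ∉ U} be the rigid stabilizer of U in Ŝ. Then RStab_Ŝ(U) equals the subgroup of Homeo(C) generated by {x_{10s}, y_{10s} : s ∈ {0,1}^{<ℕ}}, and there is a group isomorphism ξ : RStab_Ŝ(U) → _yG_y satisfying ξ(x_{10s}) = x_s and ξ(y_{10s}) = y_s for all s ∈ {0,1}^{<ℕ}. -/

import Mathlib

/-- The Cantor set of infinite binary sequences. -/
abbrev Cantor : Type := ℕ → Bool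

/-- Concatenation of a finite binary sequence with an infinite binary sequence. -/
def cat (s : List Bool) (η : Cantor) : Cantor :=
  fun n => if h : n < s.length then s.get ⟨n, h⟩ else η (n - s.length)

/-- `s` is a (finite) prefix of the infinite sequence `ξ`. -/
def IsPrefixOf (s : List Bool) (ξ : Cantor) : Prop := ∃ η : Cantor, ξ = cat s η

/-- The group of self-homeomorphisms of a topological space, with
`(f * g) ξ = f (g ξ)` (i.e. in the right-action convention `ξ·(g h) = (ξ·g)·h`,
the product `g * f` corresponds to the word "apply `f`, then `g`"). -/
instance {α : Type*} [TopologicalSpace α] : Group (α ≃ₜ α) where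
  mul f g := g.trans f
  one := Homeomorph.refl α
  inv := Homeomorph.symm
  mul_assoc _ _ _ := Homeomorph.ext fun _ => rfl
  one_mul _ := Homeomorph.ext fun _ => rfl
  mul_one _ := Homeomorph.ext fun _ => rfl
  inv_mul_cancel f := Homeomorph.ext fun ξ => f.symm_apply_apply ξ

@[simp] lemma homeo_mul_apply {α : Type*} [TopologicalSpace α] (f g : α ≃ₜ α) (ξ : α) :
    (f * g) ξ = f (g ξ) := rfl

@[simp] lemma homeo_one_apply {α : Type*} [TopologicalSpace α] (ξ : α) :
    (1 : α ≃ₜ α) ξ = ξ := rfl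

@[simp] lemma homeo_inv_apply {α : Type*} [TopologicalSpace α] (f : α ≃ₜ α) (ξ : α) :
    (f⁻¹ : α ≃ₜ α) ξ = f.symm ξ := rfl

/-- The data of the basic homeomorphisms `x`, `y`, `x_s`, `y_s`, `p_n` of the Cantor
set, together with their recursive defining equations. -/
structure LMData where
  x : Cantor ≃ₜ Cantor
  y : Cantor ≃ₜ Cantor
  xx : List Bool → Cantor ≃ₜ Cantor
  yy : List Bool → Cantor ≃ₜ Cantor
  p : ℕ → Cantor ≃ₜ Cantor
  hx00 : ∀ η, x (cat [false, false] η) = cat [false] η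
  hx01 : ∀ η, x (cat [false, true] η) = cat [true, false] η
  hx1 : ∀ η, x (cat [true] η) = cat [true, true] η
  hy00 : ∀ η, y (cat [false, false] η) = cat [false] (y η)
  hy01 : ∀ η, y (cat [false, true] η) = cat [true, false] (y.symm η)
  hy1 : ∀ η, y (cat [true] η) = cat [true, true] (y η)
  hxx : ∀ s η, xx s (cat s η) = cat s (x η)
  hxx' : ∀ s ξ, ¬ IsPrefixOf s ξ → xx s ξ = ξ
  hyy : ∀ s η, yy s (cat s η) = cat s (y η)
  hyy' : ∀ s ξ, ¬ IsPrefixOf s ξ → yy s ξ = ξ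
  hp1 : ∀ n k η, k < n → p n (cat (List.replicate k true ++ [false]) η) =
      cat (List.replicate (k + 1) true ++ [false]) η
  hp2 : ∀ n η, p n (cat (List.replicate n true ++ [false]) η) =
      cat (List.replicate (n + 1) true) η
  hp3 : ∀ n η, p n (cat (List.replicate (n + 1) true) η) = cat [false] η

/-- Thompson's group `T`, generated by all `x_s` and all `p_n`. -/
def Tgrp (D : LMData) : Subgroup (Cantor ≃ₜ Cantor) :=
  Subgroup.closure (Set.range D.xx ∪ Set.range D.p)

/-- The group `Ŝ`, generated by all `x_s`, all `y_s` and all `p_n`. -/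
def Shat (D : LMData) : Subgroup (Cantor ≃ₜ Cantor) :=
  Subgroup.closure (Set.range D.xx ∪ Set.range D.yy ∪ Set.range D.p)

/-- The homeomorphism `y₁₀ y₁₁₀⁻¹` (right-action word: first `y₁₀`, then `y₁₁₀⁻¹`). -/
def sgen (D : LMData) : Cantor ≃ₜ Cantor :=
  (D.yy [true, true, false])⁻¹ * D.yy [true, false]

/-- The group `S`, generated by Thompson's group `T` together with `y₁₀ y₁₁₀⁻¹`. -/
def Sgrp (D : LMData) : Subgroup (Cantor ≃ₜ Cantor) :=
  Subgroup.closure (↑(Tgrp D) ∪ {sgen D})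

/-- The Lodha–Moore group `_yG_y`, generated by all `x_s` and all `y_s`. -/
def LMgrp (D : LMData) : Subgroup (Cantor ≃ₜ Cantor) :=
  Subgroup.closure (Set.range D.xx ∪ Set.range D.yy)

/-- The subgroup of self-homeomorphisms of the Cantor set fixing a set `A` pointwise. -/
def fixingSubgroup' (A : Set Cantor) : Subgroup (Cantor ≃ₜ Cantor) where
  carrier := {g | ∀ ξ ∈ A, g ξ = ξ}
  one_mem' := fun ξ _ => rfl
  mul_mem' := by
    intro f g hf hg ξ hξ
    show f (g ξ) = ξ
    rw [hg ξ hξ, hf ξ hξ]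
  inv_mem' := by
    intro g hg ξ hξ
    show g.symm ξ = ξ
    refine g.injective ?_
    rw [g.apply_symm_apply, hg ξ hξ]

/-- The rigid stabilizer in `Ŝ` of the cylinder `U = {10η : η ∈ C}`: elements of `Ŝ`
fixing every point outside `U`. -/
def RStabU (D : LMData) : Subgroup (Cantor ≃ₜ Cantor) :=
  Shat D ⊓ fixingSubgroup' {ξ : Cantor | ¬ IsPrefixOf [true, false] ξ}

namespace LodhaMoore

/-! ### Prepending a letter -/

/-- Prepend a letter to an infinite binary sequence. -/
def cons (b : Bool) (η : Cantor) : Cantor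
  | 0 => b
  | n + 1 => η n

/-- Delete the first letter of an infinite binary sequence. -/
def tail (ξ : Cantor) : Cantor := fun n => ξ (n + 1)

@[simp] lemma cons_zero (b : Bool) (η : Cantor) : cons b η 0 = b := rfl

@[simp] lemma tail_cons (b : Bool) (η : Cantor) : tail (cons b η) = η := rfl

lemma cons_tail (ξ : Cantor) : cons (ξ 0) (tail ξ) = ξ := by
  funext n
  cases n <;> rfl

lemma exists_eq_cons (ξ : Cantor) : ∃ b η, ξ = cons b η := ⟨ξ 0, tail ξ, (cons_tail ξ).symm⟩

@[simp] lemma cons_inj {a b : Bool} {η ζ : Cantor} : cons a η = cons b ζ ↔ a = b ∧ η = ζ := by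
  refine ⟨fun h => ⟨congrFun h 0, congrArg tail h⟩, ?_⟩
  rintro ⟨rfl, rfl⟩
  rfl

@[simp] lemma cat_nil (η : Cantor) : cat [] η = η := by
  funext n
  simp [cat]

@[simp] lemma cat_cons (b : Bool) (s : List Bool) (η : Cantor) :
    cat (b :: s) η = cons b (cat s η) := by
  funext n
  cases n <;> simp [cat, cons]

@[simp] lemma cat_append (s t : List Bool) (η : Cantor) : cat (s ++ t) η = cat s (cat t η) := by
  induction s <;> simp_all

lemma isPrefixOf_cons {a b : Bool} {s : List Bool} {η : Cantor} :
    IsPrefixOf (b :: s) (cons a η) ↔ a = b ∧ IsPrefixOf s η := by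
  simp [IsPrefixOf]

lemma isPrefixOf_nil (η : Cantor) : IsPrefixOf [] η := ⟨η, by simp⟩

lemma continuous_cons (b : Bool) : Continuous (cons b) := by
  refine continuous_pi fun n => ?_
  cases n
  · exact continuous_const
  · exact continuous_apply _

lemma continuous_tail : Continuous tail := continuous_pi fun n => continuous_apply (n + 1)

/-! ### Copies of a homeomorphism on cylinders -/

/-- The map acting as `h` after the letter `b` and fixing everything else. -/
def consMap (b : Bool) (h : Cantor → Cantor) (ξ : Cantor) : Cantor :=
  if ξ 0 = b then cons b (h (tail ξ)) else ξ

@[simp] lemma consMap_cons (b a : Bool) (h : Cantor → Cantor) (η : Cantor) :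
    consMap b h (cons a η) = if a = b then cons b (h η) else cons a η := rfl

lemma continuous_consMap (b : Bool) {h : Cantor → Cantor} (hh : Continuous h) :
    Continuous (consMap b h) := by
  have hclopen : IsClopen {ξ : Cantor | ξ 0 = b} :=
    (isClopen_discrete {b}).preimage (continuous_apply 0)
  refine continuous_if ?_ ?_ ?_
  · simp [hclopen.frontier_eq]
  · exact ((continuous_cons b).comp (hh.comp continuous_tail)).continuousOn
  · exact continuousOn_id

/-- The homeomorphism acting as `h` after the letter `b` and fixing everything else. -/
def consHom (b : Bool) : (Cantor ≃ₜ Cantor) →* (Cantor ≃ₜ Cantor) where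
  toFun h :=
    { toFun := consMap b h
      invFun := consMap b h.symm
      left_inv := fun ξ => by
        obtain ⟨a, η, rfl⟩ := exists_eq_cons ξ
        by_cases hab : a = b <;> simp [hab]
      right_inv := fun ξ => by
        obtain ⟨a, η, rfl⟩ := exists_eq_cons ξ
        by_cases hab : a = b <;> simp [hab]
      continuous_toFun := continuous_consMap b h.continuous
      continuous_invFun := continuous_consMap b h.symm.continuous }
  map_one' := Homeomorph.ext fun ξ => by
    obtain ⟨a, η, rfl⟩ := exists_eq_cons ξ
    by_cases hab : a = b <;> simp [hab]
  map_mul' f g := Homeomorph.ext fun ξ => by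
    obtain ⟨a, η, rfl⟩ := exists_eq_cons ξ
    by_cases hab : a = b <;> simp [hab]

@[simp] lemma consHom_apply_cons (b a : Bool) (h : Cantor ≃ₜ Cantor) (η : Cantor) :
    consHom b h (cons a η) = if a = b then cons b (h η) else cons a η := rfl

/-- The homeomorphism acting as `h` on the cylinder of `s` and fixing everything else. -/
def lift : List Bool → (Cantor ≃ₜ Cantor) →* (Cantor ≃ₜ Cantor)
  | [] => MonoidHom.id _
  | b :: s => (consHom b).comp (lift s)

@[simp] lemma lift_nil (h : Cantor ≃ₜ Cantor) : lift [] h = h := rfl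

@[simp] lemma lift_cons (b : Bool) (s : List Bool) (h : Cantor ≃ₜ Cantor) :
    lift (b :: s) h = consHom b (lift s h) := rfl

lemma lift_append (s t : List Bool) (h : Cantor ≃ₜ Cantor) :
    lift (s ++ t) h = lift s (lift t h) := by
  induction s <;> simp_all

lemma lift_cat (s : List Bool) (h : Cantor ≃ₜ Cantor) (η : Cantor) :
    lift s h (cat s η) = cat s (h η) := by
  induction s <;> simp_all

lemma lift_of_not_isPrefixOf (s : List Bool) (h : Cantor ≃ₜ Cantor) (ξ : Cantor)
    (hξ : ¬ IsPrefixOf s ξ) : lift s h ξ = ξ := by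
  induction s generalizing ξ with
  | nil => exact absurd (isPrefixOf_nil ξ) hξ
  | cons b s ih =>
    obtain ⟨a, η, rfl⟩ := exists_eq_cons ξ
    rw [isPrefixOf_cons] at hξ
    by_cases hab : a = b
    · simp [hab, ih η fun h => hξ ⟨hab, h⟩]
    · simp [hab]

lemma eq_lift {s : List Bool} {f h : Cantor ≃ₜ Cantor} (hf : ∀ η, f (cat s η) = cat s (h η))
    (hf' : ∀ ξ, ¬ IsPrefixOf s ξ → f ξ = ξ) : f = lift s h := by
  refine Homeomorph.ext fun ξ => ?_
  by_cases hξ : IsPrefixOf s ξ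
  · obtain ⟨η, rfl⟩ := hξ
    rw [hf, lift_cat]
  · rw [hf' ξ hξ, lift_of_not_isPrefixOf s h ξ hξ]

lemma lift_injective (s : List Bool) : Function.Injective (lift s) := by
  induction s with
  | nil => exact fun _ _ h => h
  | cons b s ih =>
    intro f g hfg
    refine ih (Homeomorph.ext fun η => ?_)
    simpa using DFunLike.congr_fun hfg (cons b η)

/-! ### The generators -/

section Generators

variable (D : LMData)

lemma xx_eq_lift (s : List Bool) : D.xx s = lift s D.x := eq_lift (D.hxx s) (D.hxx' s)

lemma yy_eq_lift (s : List Bool) : D.yy s = lift s D.y := eq_lift (D.hyy s) (D.hyy' s)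

lemma consHom_xx (b : Bool) (s : List Bool) : consHom b (D.xx s) = D.xx (b :: s) := by
  simp [xx_eq_lift]

lemma consHom_yy (b : Bool) (s : List Bool) : consHom b (D.yy s) = D.yy (b :: s) := by
  simp [yy_eq_lift]

lemma x_zero_zero (η : Cantor) : D.x (cons false (cons false η)) = cons false η := by
  simpa using D.hx00 η

lemma x_zero_one (η : Cantor) :
    D.x (cons false (cons true η)) = cons true (cons false η) := by
  simpa using D.hx01 η

lemma x_one (η : Cantor) : D.x (cons true η) = cons true (cons true η) := by
  simpa using D.hx1 η

lemma y_zero_zero (η : Cantor) : D.y (cons false (cons false η)) = cons false (D.y η) := by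
  simpa using D.hy00 η

lemma y_zero_one (η : Cantor) :
    D.y (cons false (cons true η)) = cons true (cons false (D.y.symm η)) := by
  simpa using D.hy01 η

lemma y_one (η : Cantor) : D.y (cons true η) = cons true (cons true (D.y η)) := by
  simpa using D.hy1 η

lemma x_symm_zero (η : Cantor) : D.x.symm (cons false η) = cons false (cons false η) := by
  rw [Homeomorph.symm_apply_eq, x_zero_zero]

lemma x_symm_one_zero (η : Cantor) :
    D.x.symm (cons true (cons false η)) = cons false (cons true η) := by
  rw [Homeomorph.symm_apply_eq, x_zero_one]

lemma x_symm_one_one (η : Cantor) : D.x.symm (cons true (cons true η)) = cons true η := by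
  rw [Homeomorph.symm_apply_eq, x_one]

lemma y_symm_zero (η : Cantor) :
    D.y.symm (cons false η) = cons false (cons false (D.y.symm η)) := by
  rw [Homeomorph.symm_apply_eq, y_zero_zero, Homeomorph.apply_symm_apply]

lemma y_symm_one_zero (η : Cantor) :
    D.y.symm (cons true (cons false η)) = cons false (cons true (D.y η)) := by
  rw [Homeomorph.symm_apply_eq, y_zero_one, Homeomorph.symm_apply_apply]

lemma y_symm_one_one (η : Cantor) :
    D.y.symm (cons true (cons true η)) = cons true (D.y.symm η) := by
  rw [Homeomorph.symm_apply_eq, y_one, Homeomorph.apply_symm_apply]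

lemma p_zero_cons (b : Bool) (η : Cantor) : D.p 0 (cons b η) = cons (!b) η := by
  cases b
  · simpa using D.hp2 0 η
  · simpa using D.hp3 0 η

lemma p_zero_symm_cons (b : Bool) (η : Cantor) : (D.p 0).symm (cons b η) = cons (!b) η := by
  simp [Homeomorph.symm_apply_eq, p_zero_cons]

lemma p_succ_mul (n : ℕ) : D.p (n + 1) * D.xx (List.replicate n true) = D.p n := by
  refine Homeomorph.ext fun ξ => ?_
  have key : (∃ k < n, ∃ η, ξ = cat (List.replicate k true ++ [false]) η) ∨
      ∃ η, ξ = cat (List.replicate n true) η := by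
    induction n generalizing ξ with
    | zero => exact Or.inr ⟨ξ, by simp⟩
    | succ n ih =>
      obtain ⟨b, ζ, rfl⟩ := exists_eq_cons ξ
      cases b with
      | false => exact Or.inl ⟨0, by omega, ζ, by simp⟩
      | true =>
        rcases ih ζ with ⟨k, hk, η, rfl⟩ | ⟨η, rfl⟩
        · exact Or.inl ⟨k + 1, by omega, η, by simp [List.replicate_succ]⟩
        · exact Or.inr ⟨η, by simp [List.replicate_succ]⟩
  rw [homeo_mul_apply]
  rcases key with ⟨k, hk, η, rfl⟩ | ⟨η, rfl⟩
  · rw [D.hp1 n k η hk, D.hxx', D.hp1 (n + 1) k η (by omega)]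
    intro h
    induction k generalizing n with
    | zero =>
      obtain ⟨m, rfl⟩ : ∃ m, n = m + 1 := ⟨n - 1, by omega⟩
      simp [List.replicate_succ, isPrefixOf_cons] at h
    | succ k ih =>
      obtain ⟨m, rfl⟩ : ∃ m, n = m + 1 := ⟨n - 1, by omega⟩
      rw [List.replicate_succ, List.replicate_succ, List.cons_append, cat_cons,
        isPrefixOf_cons] at h
      exact ih m (by omega) h.2
  · rw [D.hxx]
    have h0 := D.hp1 (n + 1) n
    have h1 := D.hp2 (n + 1)
    have h2 := D.hp3 (n + 1)
    have h3 := D.hp2 n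
    have h4 := D.hp3 n
    simp only [List.replicate_succ', cat_append, cat_cons, cat_nil] at h0 h1 h2 h3 h4
    obtain ⟨b, η, rfl⟩ := exists_eq_cons η
    cases b with
    | true => rw [x_one, h2, h4]
    | false =>
      obtain ⟨b, η, rfl⟩ := exists_eq_cons η
      cases b with
      | false => rw [x_zero_zero, h0 _ (by omega), h3]
      | true => rw [x_zero_one, h1, h3]

/-- A subgroup containing all `x_s`, all `y_s` and `p_0` contains `Ŝ`. -/
lemma shat_le {H : Subgroup (Cantor ≃ₜ Cantor)} (hx : ∀ s, D.xx s ∈ H) (hy : ∀ s, D.yy s ∈ H)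
    (hp : D.p 0 ∈ H) : Shat D ≤ H := by
  have hp' : ∀ n, D.p n ∈ H := by
    intro n
    induction n with
    | zero => exact hp
    | succ n ih => rwa [← p_succ_mul D n, H.mul_mem_cancel_right (hx _)] at ih
  rw [Shat, Subgroup.closure_le]
  rintro _ ((⟨s, rfl⟩ | ⟨s, rfl⟩) | ⟨n, rfl⟩)
  exacts [hx s, hy s, hp' n]

lemma lmgrp_le {H : Subgroup (Cantor ≃ₜ Cantor)} (hx : ∀ s, D.xx s ∈ H)
    (hy : ∀ s, D.yy s ∈ H) : LMgrp D ≤ H := by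
  rw [LMgrp, Subgroup.closure_le]
  rintro _ (⟨s, rfl⟩ | ⟨s, rfl⟩)
  exacts [hx s, hy s]

lemma xx_mem_lmgrp (s : List Bool) : D.xx s ∈ LMgrp D :=
  Subgroup.subset_closure (Or.inl ⟨s, rfl⟩)

lemma yy_mem_lmgrp (s : List Bool) : D.yy s ∈ LMgrp D :=
  Subgroup.subset_closure (Or.inr ⟨s, rfl⟩)

lemma x_mem_lmgrp : D.x ∈ LMgrp D := by simpa [xx_eq_lift] using xx_mem_lmgrp D []

lemma y_mem_lmgrp : D.y ∈ LMgrp D := by simpa [yy_eq_lift] using yy_mem_lmgrp D []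

lemma consHom_mem_lmgrp (b : Bool) {h : Cantor ≃ₜ Cantor} (hh : h ∈ LMgrp D) :
    consHom b h ∈ LMgrp D := by
  have : LMgrp D ≤ (LMgrp D).comap (consHom b) :=
    lmgrp_le D (fun s => by simpa [consHom_xx] using xx_mem_lmgrp D _)
      fun s => by simpa [consHom_yy] using yy_mem_lmgrp D _
  exact this hh

end Generators

/-! ### The lexicographic order and the cyclic order -/

/-- `ξ` is lexicographically smaller than `ζ`, the first difference being at position `n`. -/
def LtAt : ℕ → Cantor → Cantor → Prop
  | 0, ξ, ζ => ξ 0 = false ∧ ζ 0 = true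
  | n + 1, ξ, ζ => ξ 0 = ζ 0 ∧ LtAt n (tail ξ) (tail ζ)

/-- The lexicographic order. -/
def Lt (ξ ζ : Cantor) : Prop := ∃ n, LtAt n ξ ζ

@[simp] lemma ltAt_zero_cons {a b : Bool} {η ζ : Cantor} :
    LtAt 0 (cons a η) (cons b ζ) ↔ a = false ∧ b = true := Iff.rfl

@[simp] lemma ltAt_succ_cons {n : ℕ} {a b : Bool} {η ζ : Cantor} :
    LtAt (n + 1) (cons a η) (cons b ζ) ↔ a = b ∧ LtAt n η ζ := Iff.rfl

@[simp] lemma lt_cons {a b : Bool} {η ζ : Cantor} :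
    Lt (cons a η) (cons b ζ) ↔ (a = false ∧ b = true) ∨ (a = b ∧ Lt η ζ) := by
  constructor
  · rintro ⟨_ | n, h⟩
    · exact Or.inl h
    · exact Or.inr ⟨h.1, n, h.2⟩
  · rintro (h | ⟨h, n, h'⟩)
    · exact ⟨0, h⟩
    · exact ⟨n + 1, h, h'⟩

lemma lt_irrefl (ξ : Cantor) : ¬ Lt ξ ξ := by
  rintro ⟨n, h⟩
  induction n generalizing ξ with
  | zero => simp [LtAt] at h
  | succ n ih => exact ih _ h.2

/-- The cyclic order induced by the lexicographic order. -/
def Cyc (a b c : Cantor) : Prop := (Lt a b ∧ Lt b c) ∨ (Lt b c ∧ Lt c a) ∨ (Lt c a ∧ Lt a b)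

/-- The homeomorphisms preserving the lexicographic order. -/
def orderSubgroup : Subgroup (Cantor ≃ₜ Cantor) where
  carrier := {g | ∀ a b, Lt (g a) (g b) ↔ Lt a b}
  one_mem' := fun _ _ => Iff.rfl
  mul_mem' := fun hf hg a b => (hf _ _).trans (hg a b)
  inv_mem' := fun {g} hg a b => by
    rw [← hg]
    simp

/-- The homeomorphisms preserving the cyclic order. -/
def cycSubgroup : Subgroup (Cantor ≃ₜ Cantor) where
  carrier := {g | ∀ a b c, Cyc (g a) (g b) (g c) ↔ Cyc a b c}
  one_mem' := fun _ _ _ => Iff.rfl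
  mul_mem' := fun hf hg a b c => (hf _ _ _).trans (hg a b c)
  inv_mem' := fun {g} hg a b c => by
    rw [← hg]
    simp

lemma orderSubgroup_le_cycSubgroup : orderSubgroup ≤ cycSubgroup := by
  intro g hg a b c
  simp only [Cyc, hg _ _]

lemma consHom_mem_orderSubgroup (b : Bool) {h : Cantor ≃ₜ Cantor} (hh : h ∈ orderSubgroup) :
    consHom b h ∈ orderSubgroup := by
  intro ξ ξ'
  obtain ⟨a, η, rfl⟩ := exists_eq_cons ξ
  obtain ⟨a', η', rfl⟩ := exists_eq_cons ξ'
  cases a <;> cases a' <;> cases b <;> simp [hh _ _]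

lemma lift_mem_orderSubgroup (s : List Bool) {h : Cantor ≃ₜ Cantor} (hh : h ∈ orderSubgroup) :
    lift s h ∈ orderSubgroup := by
  induction s with
  | nil => exact hh
  | cons b s ih => exact consHom_mem_orderSubgroup b ih

section Order

variable (D : LMData)

lemma x_mem_orderSubgroup : D.x ∈ orderSubgroup := by
  intro ξ ξ'
  obtain ⟨a, η, rfl⟩ := exists_eq_cons ξ
  obtain ⟨a', η', rfl⟩ := exists_eq_cons ξ'
  obtain ⟨b, ζ, rfl⟩ := exists_eq_cons η
  obtain ⟨b', ζ', rfl⟩ := exists_eq_cons η'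
  cases a <;> cases a' <;> cases b <;> cases b' <;>
    simp [x_zero_zero, x_zero_one, x_one]

lemma lt_y_of_ltAt (n : ℕ) : ∀ ξ ξ', LtAt n ξ ξ' →
    Lt (D.y ξ) (D.y ξ') ∧ Lt (D.y.symm ξ) (D.y.symm ξ') := by
  induction n using Nat.strong_induction_on with
  | _ n ih =>
    intro ξ ξ' h
    obtain ⟨a, η, rfl⟩ := exists_eq_cons ξ
    obtain ⟨a', η', rfl⟩ := exists_eq_cons ξ'
    obtain ⟨b, ζ, rfl⟩ := exists_eq_cons η
    obtain ⟨b', ζ', rfl⟩ := exists_eq_cons η'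
    rcases n with _ | n
    · obtain ⟨rfl, rfl⟩ := h
      cases b <;> cases b' <;>
        simp [y_zero_zero, y_zero_one, y_one, y_symm_zero, y_symm_one_zero, y_symm_one_one]
    · obtain ⟨rfl, h₁⟩ := ltAt_succ_cons.1 h
      have ih₁ := ih n (by omega) _ _ h₁
      rcases n with _ | n
      · obtain ⟨rfl, rfl⟩ := ltAt_zero_cons.1 h₁
        cases a <;>
          simp_all [y_zero_zero, y_zero_one, y_one, y_symm_zero, y_symm_one_zero, y_symm_one_one]
      · obtain ⟨rfl, h₂⟩ := ltAt_succ_cons.1 h₁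
        have ih₂ := ih n (by omega) _ _ h₂
        cases a <;> cases b <;>
          simp_all [y_zero_zero, y_zero_one, y_one, y_symm_zero, y_symm_one_zero, y_symm_one_one]

lemma y_mem_orderSubgroup : D.y ∈ orderSubgroup := by
  refine fun ξ ξ' => ⟨?_, fun ⟨n, h⟩ => (lt_y_of_ltAt D n _ _ h).1⟩
  rintro ⟨n, h⟩
  simpa using (lt_y_of_ltAt D n _ _ h).2

lemma xx_mem_orderSubgroup (s : List Bool) : D.xx s ∈ orderSubgroup := by
  rw [xx_eq_lift]
  exact lift_mem_orderSubgroup s (x_mem_orderSubgroup D)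

lemma yy_mem_orderSubgroup (s : List Bool) : D.yy s ∈ orderSubgroup := by
  rw [yy_eq_lift]
  exact lift_mem_orderSubgroup s (y_mem_orderSubgroup D)

lemma lmgrp_le_orderSubgroup : LMgrp D ≤ orderSubgroup :=
  lmgrp_le D (xx_mem_orderSubgroup D) (yy_mem_orderSubgroup D)

lemma p_zero_mem_cycSubgroup : D.p 0 ∈ cycSubgroup := by
  intro a b c
  obtain ⟨i, a, rfl⟩ := exists_eq_cons a
  obtain ⟨j, b, rfl⟩ := exists_eq_cons b
  obtain ⟨k, c, rfl⟩ := exists_eq_cons c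
  cases i <;> cases j <;> cases k <;> simp [Cyc, p_zero_cons]

lemma shat_le_cycSubgroup : Shat D ≤ cycSubgroup :=
  shat_le D (fun s => orderSubgroup_le_cycSubgroup (xx_mem_orderSubgroup D s))
    (fun s => orderSubgroup_le_cycSubgroup (yy_mem_orderSubgroup D s)) (p_zero_mem_cycSubgroup D)

end Order

/-! ### Binary trees and Thompson's group `F` -/

/-- Finite rooted binary trees. -/
inductive BTree : Type
  | leaf : BTree
  | node : BTree → BTree → BTree

namespace BTree

/-- The addresses of the leaves, from left to right. -/
def leaves : BTree → List (List Bool)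
  | leaf => [[]]
  | node l r => l.leaves.map (false :: ·) ++ r.leaves.map (true :: ·)

/-- The right comb with `n + 1` leaves. -/
def comb : ℕ → BTree
  | 0 => leaf
  | n + 1 => node leaf (comb n)

lemma exists_leaf_prefix (t : BTree) (ξ : Cantor) : ∃ u ∈ t.leaves, IsPrefixOf u ξ := by
  induction t generalizing ξ with
  | leaf => exact ⟨[], by simp [leaves], isPrefixOf_nil ξ⟩
  | node l r ihl ihr =>
    obtain ⟨b, η, rfl⟩ := exists_eq_cons ξ
    cases b
    · obtain ⟨u, hu, h⟩ := ihl η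
      exact ⟨false :: u, by simp [leaves, hu], isPrefixOf_cons.2 ⟨rfl, h⟩⟩
    · obtain ⟨u, hu, h⟩ := ihr η
      exact ⟨true :: u, by simp [leaves, hu], isPrefixOf_cons.2 ⟨rfl, h⟩⟩

end BTree

open BTree

/-- Every element of the cylinder of `u` is smaller than every element of the cylinder of `v`. -/
def Before (u v : List Bool) : Prop := ∀ η ζ, Lt (cat u η) (cat v ζ)

lemma before_cons_self {b : Bool} {u v : List Bool} :
    Before (b :: u) (b :: v) ↔ Before u v := by
  simp [Before]

lemma not_before_nil_left (v : List Bool) : ¬ Before [] v := fun h =>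
  lt_irrefl (cat v fun _ => false) (by simpa using h (cat v fun _ => false) fun _ => false)

lemma not_before_nil_right (u : List Bool) : ¬ Before u [] := fun h =>
  lt_irrefl (cat u fun _ => false) (by simpa using h (fun _ => false) (cat u fun _ => false))

lemma pairwise_leaves (t : BTree) : t.leaves.Pairwise Before := by
  induction t with
  | leaf => simp [leaves]
  | node l r ihl ihr =>
    simp only [leaves, List.pairwise_append, List.pairwise_map, before_cons_self]
    refine ⟨ihl, ihr, ?_⟩
    simp [Before]

lemma eq_singleton_nil_of_mem {L : List (List Bool)} (hL : L.Pairwise Before) (h : [] ∈ L) :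
    L = [[]] := by
  obtain ⟨A, B, rfl⟩ := List.append_of_mem h
  rw [List.pairwise_append, List.pairwise_cons] at hL
  obtain ⟨-, ⟨hB, -⟩, hA⟩ := hL
  have hA' : A = [] := List.eq_nil_iff_forall_not_mem.2 fun a ha =>
    not_before_nil_right a (hA a ha [] (by simp))
  have hB' : B = [] := List.eq_nil_iff_forall_not_mem.2 fun b hb => not_before_nil_left b (hB b hb)
  simp [hA', hB']

lemma exists_split {L : List (List Bool)} (hL : L.Pairwise Before) (h : [] ∉ L) :
    ∃ A B : List (List Bool), L = A.map (false :: ·) ++ B.map (true :: ·) := by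
  induction L with
  | nil => exact ⟨[], [], rfl⟩
  | cons w L ih =>
    rw [List.pairwise_cons] at hL
    obtain ⟨A, B, rfl⟩ := ih hL.2 fun h' => h (List.mem_cons_of_mem _ h')
    rcases w with _ | ⟨b, w⟩
    · simp at h
    · cases b with
      | false => exact ⟨w :: A, B, rfl⟩
      | true =>
        rcases A with _ | ⟨a, A⟩
        · exact ⟨[], w :: B, rfl⟩
        · have := hL.1 (false :: a) (by simp) (fun _ => false) (fun _ => false)
          simp at this

/-- An increasing list of words whose cylinders cover the Cantor set is the list of leaves of a
tree. -/
lemma exists_leaves_eq (N : ℕ) (L : List (List Bool)) (hN : ∀ w ∈ L, w.length ≤ N)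
    (hL : L.Pairwise Before) (hcov : ∀ ξ, ∃ w ∈ L, IsPrefixOf w ξ) :
    ∃ t : BTree, t.leaves = L := by
  induction N generalizing L with
  | zero =>
    obtain ⟨w, hw, -⟩ := hcov fun _ => false
    obtain rfl : w = [] := List.length_eq_zero_iff.1 (Nat.le_zero.1 (hN w hw))
    exact ⟨leaf, (eq_singleton_nil_of_mem hL hw).symm⟩
  | succ N ih =>
    by_cases h : [] ∈ L
    · exact ⟨leaf, (eq_singleton_nil_of_mem hL h).symm⟩
    obtain ⟨A, B, rfl⟩ := exists_split hL h
    simp only [List.pairwise_append, List.pairwise_map, before_cons_self] at hL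
    obtain ⟨l, rfl⟩ := ih A
      (fun w hw => by simpa using hN (false :: w) (by simp [hw])) hL.1 fun ξ => by
        obtain ⟨w, hw, hξ⟩ := hcov (cons false ξ)
        simp only [List.mem_append, List.mem_map] at hw
        rcases hw with ⟨w, hw, rfl⟩ | ⟨w, hw, rfl⟩
        · exact ⟨w, hw, (isPrefixOf_cons.1 hξ).2⟩
        · simp [isPrefixOf_cons] at hξ
    obtain ⟨r, rfl⟩ := ih B
      (fun w hw => by simpa using hN (true :: w) (by simp [hw])) hL.2.1 fun ξ => by
        obtain ⟨w, hw, hξ⟩ := hcov (cons true ξ)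
        simp only [List.mem_append, List.mem_map] at hw
        rcases hw with ⟨w, hw, rfl⟩ | ⟨w, hw, rfl⟩
        · simp [isPrefixOf_cons] at hξ
        · exact ⟨w, hw, (isPrefixOf_cons.1 hξ).2⟩
    exact ⟨node l r, rfl⟩

section TreePairs

variable (D : LMData)

/-- Some element of the Lodha–Moore group maps the leaves of `t` to those of `t'` in order, by
prefix replacement. -/
def TreeRel (t t' : BTree) : Prop :=
  ∃ k ∈ LMgrp D, List.Forall₂ (fun u v => ∀ η, k (cat u η) = cat v η) t.leaves t'.leaves

variable {D}

lemma TreeRel.refl (t : BTree) : TreeRel D t t :=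
  ⟨1, one_mem _, List.forall₂_same.2 fun _ _ _ => rfl⟩

lemma TreeRel.symm {t t' : BTree} : TreeRel D t t' → TreeRel D t' t := by
  rintro ⟨k, hk, h⟩
  refine ⟨k⁻¹, inv_mem hk, h.flip.imp fun u v huv η => ?_⟩
  rw [homeo_inv_apply, Homeomorph.symm_apply_eq, huv]

lemma forall₂_trans {α : Type*} {R S T : α → α → Prop} (hRS : ∀ a b c, R a b → S b c → T a c)
    {l₁ l₂ l₃ : List α} (h₁ : List.Forall₂ R l₁ l₂) (h₂ : List.Forall₂ S l₂ l₃) :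
    List.Forall₂ T l₁ l₃ := by
  induction h₁ generalizing l₃ with
  | nil => cases h₂; exact .nil
  | cons h _ ih =>
    cases h₂ with
    | cons h' h₂ => exact .cons (hRS _ _ _ h h') (ih h₂)

lemma TreeRel.trans {t t' t'' : BTree} :
    TreeRel D t t' → TreeRel D t' t'' → TreeRel D t t'' := by
  rintro ⟨k, hk, h⟩ ⟨k', hk', h'⟩
  refine ⟨k' * k, mul_mem hk' hk, forall₂_trans (fun u v w huv hvw η => ?_) h h'⟩
  rw [homeo_mul_apply, huv, hvw]

lemma TreeRel.node {l r l' r' : BTree} :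
    TreeRel D l l' → TreeRel D r r' → TreeRel D (node l r) (node l' r') := by
  rintro ⟨k, hk, h⟩ ⟨k', hk', h'⟩
  refine ⟨consHom false k * consHom true k',
    mul_mem (consHom_mem_lmgrp D _ hk) (consHom_mem_lmgrp D _ hk'), ?_⟩
  refine List.rel_append ?_ ?_
  · rw [List.forall₂_map_left_iff, List.forall₂_map_right_iff]
    exact h.imp fun u v huv η => by simp [huv]
  · rw [List.forall₂_map_left_iff, List.forall₂_map_right_iff]
    exact h'.imp fun u v huv η => by simp [huv]

lemma treeRel_rotate (a b c : BTree) :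
    TreeRel D (node (node a b) c) (node a (node b c)) := by
  refine ⟨D.x, x_mem_lmgrp D, ?_⟩
  simp only [leaves, List.map_append, List.map_map, List.append_assoc]
  refine List.rel_append ?_ (List.rel_append ?_ ?_)
  all_goals
    rw [List.forall₂_map_left_iff, List.forall₂_map_right_iff]
    refine List.forall₂_same.2 fun u _ η => ?_
    simp [x_zero_zero, x_zero_one, x_one]

lemma treeRel_comb_node_comb (m n : ℕ) :
    TreeRel D (node (comb m) (comb n)) (comb (m + n + 1)) := by
  induction m with
  | zero => simpa [comb] using TreeRel.refl _
  | succ m ih =>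
    rw [show m + 1 + n + 1 = (m + n + 1) + 1 by omega]
    exact (treeRel_rotate _ _ _).trans ((TreeRel.refl _).node ih)

lemma length_leaves_comb (n : ℕ) : (comb n).leaves.length = n + 1 := by
  induction n with
  | zero => rfl
  | succ n ih => simp [comb, leaves, ih]

lemma exists_treeRel_comb (t : BTree) : ∃ n, TreeRel D t (comb n) := by
  induction t with
  | leaf => exact ⟨0, TreeRel.refl _⟩
  | node l r ihl ihr =>
    obtain ⟨m, hm⟩ := ihl
    obtain ⟨n, hn⟩ := ihr
    exact ⟨_, (hm.node hn).trans (treeRel_comb_node_comb m n)⟩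

lemma treeRel_of_length_eq {t t' : BTree} (h : t.leaves.length = t'.leaves.length) :
    TreeRel D t t' := by
  obtain ⟨m, hm⟩ := exists_treeRel_comb (D := D) t
  obtain ⟨n, hn⟩ := exists_treeRel_comb (D := D) t'
  obtain rfl : m = n := by
    obtain ⟨_, _, hm⟩ := hm
    obtain ⟨_, _, hn⟩ := hn
    have hm := hm.length_eq
    have hn := hn.length_eq
    rw [length_leaves_comb] at hm hn
    omega
  exact hm.trans hn.symm

end TreePairs

/-! ### Piecewise prefix replacements -/

/-- The maps which, on each cylinder of some finite partition into cylinders, replace one prefix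
by another. -/
inductive PrefixRepl : (Cantor → Cantor) → Prop
  | base (α : Cantor → Cantor) (w : List Bool) : (∀ η, α η = cat w η) → PrefixRepl α
  | node (α : Cantor → Cantor) : PrefixRepl (fun η => α (cons false η)) →
      PrefixRepl (fun η => α (cons true η)) → PrefixRepl α

lemma PrefixRepl.exists_tree {α : Cantor → Cantor} (h : PrefixRepl α) :
    ∃ (t : BTree) (f : List Bool → List Bool), ∀ u ∈ t.leaves, ∀ η, α (cat u η) = cat (f u) η := by
  suffices ∃ t : BTree, ∀ u ∈ t.leaves, ∃ w, ∀ η, α (cat u η) = cat w η by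
    obtain ⟨t, ht⟩ := this
    choose! f hf using ht
    exact ⟨t, f, hf⟩
  induction h with
  | base α w h => exact ⟨leaf, by simpa [leaves] using ⟨w, h⟩⟩
  | node α _ _ ihl ihr =>
    obtain ⟨l, hl⟩ := ihl
    obtain ⟨r, hr⟩ := ihr
    refine ⟨BTree.node l r, fun u hu => ?_⟩
    simp only [leaves, List.mem_append, List.mem_map] at hu
    rcases hu with ⟨u, hu, rfl⟩ | ⟨u, hu, rfl⟩
    · simpa using hl u hu
    · simpa using hr u hu

lemma PrefixRepl.cons_comp {α : Cantor → Cantor} (h : PrefixRepl α) (b : Bool) :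
    PrefixRepl fun η => cons b (α η) := by
  induction h with
  | base α w h => exact .base _ (b :: w) fun η => by simp [h]
  | node α _ _ ihl ihr => exact .node _ ihl ihr

lemma PrefixRepl.of_cons_comp {α : Cantor → Cantor} {b : Bool}
    (h : PrefixRepl fun η => cons b (α η)) : PrefixRepl α := by
  generalize hβ : (fun η => cons b (α η)) = β at h
  induction h generalizing α with
  | base β w h =>
    subst hβ
    rcases w with _ | ⟨a, w⟩
    · simpa using congrFun (h (cons (!b) fun _ => false)) 0
    · exact .base _ w fun η => by simpa using And.right (by simpa using h η : b = a ∧ _)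
  | node β _ _ ihl ihr =>
    subst hβ
    exact .node _ (ihl rfl) (ihr rfl)

/-- Order-preserving piecewise prefix replacements are in (Thompson's group `F`, hence in) the
Lodha–Moore group. -/
lemma mem_lmgrp_of_prefixRepl (D : LMData) {h : Cantor ≃ₜ Cantor} (hord : h ∈ orderSubgroup)
    (hh : PrefixRepl h) : h ∈ LMgrp D := by
  obtain ⟨t, f, hf⟩ := hh.exists_tree
  obtain ⟨t', ht'⟩ := exists_leaves_eq ((t.leaves.map f).map List.length).sum (t.leaves.map f)
    (fun w hw => List.single_le_sum (by simp) _ (List.mem_map_of_mem hw))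
    (by
      rw [List.pairwise_map]
      refine (pairwise_leaves t).imp_of_mem fun {u v} hu hv huv η ζ => ?_
      rw [← hf u hu, ← hf v hv, hord]
      exact huv η ζ)
    (fun ξ => by
      obtain ⟨u, hu, η, hη⟩ := t.exists_leaf_prefix (h.symm ξ)
      refine ⟨f u, List.mem_map_of_mem hu, η, ?_⟩
      rw [← hf u hu, ← hη, Homeomorph.apply_symm_apply])
  obtain ⟨k, hk, hrel⟩ := treeRel_of_length_eq (D := D) (t := t) (t' := t') (by simp [ht'])
  rw [ht', List.forall₂_map_right_iff, List.forall₂_same] at hrel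
  convert hk
  refine Homeomorph.ext fun ξ => ?_
  obtain ⟨u, hu, η, rfl⟩ := t.exists_leaf_prefix ξ
  rw [hf u hu, hrel u hu]

/-! ### Prefix replacements up to the Lodha–Moore group -/

section Quasi

variable (D : LMData)

/-- The maps which become piecewise prefix replacements after precomposition with an element of
the Lodha–Moore group. -/
def QuasiRepl (α : Cantor → Cantor) : Prop :=
  ∃ k ∈ LMgrp D, PrefixRepl fun η => α (k η)

variable {D}

lemma PrefixRepl.quasiRepl {α : Cantor → Cantor} (h : PrefixRepl α) : QuasiRepl D α :=
  ⟨1, one_mem _, h⟩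

lemma quasiRepl_cat (w : List Bool) : QuasiRepl D (fun η => cat w η) :=
  (PrefixRepl.base _ w fun _ => rfl).quasiRepl

lemma quasiRepl_of_mem {h : Cantor ≃ₜ Cantor} (hh : h ∈ LMgrp D) : QuasiRepl D h :=
  ⟨h⁻¹, inv_mem hh, .base _ [] fun η => by simp⟩

lemma QuasiRepl.cons_comp {α : Cantor → Cantor} (h : QuasiRepl D α) (b : Bool) :
    QuasiRepl D fun η => cons b (α η) := by
  obtain ⟨k, hk, h⟩ := h
  exact ⟨k, hk, h.cons_comp b⟩

lemma QuasiRepl.node {α : Cantor → Cantor} (h₀ : QuasiRepl D fun η => α (cons false η))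
    (h₁ : QuasiRepl D fun η => α (cons true η)) : QuasiRepl D α := by
  obtain ⟨k, hk, h₀⟩ := h₀
  obtain ⟨k', hk', h₁⟩ := h₁
  refine ⟨consHom false k * consHom true k',
    mul_mem (consHom_mem_lmgrp D _ hk) (consHom_mem_lmgrp D _ hk'), .node _ ?_ ?_⟩
  · simpa using h₀
  · simpa using h₁

lemma QuasiRepl.comp_mem {α : Cantor → Cantor} (h : QuasiRepl D α) {k : Cantor ≃ₜ Cantor}
    (hk : k ∈ LMgrp D) : QuasiRepl D fun η => α (k η) := by
  obtain ⟨k', hk', h⟩ := h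
  exact ⟨k⁻¹ * k', mul_mem (inv_mem hk) hk', by simpa using h⟩

variable (D) in
/-- The maps whose composites with all prefix maps are prefix replacements up to the
Lodha–Moore group. -/
def Admissible (h : Cantor → Cantor) : Prop := ∀ w, QuasiRepl D fun η => h (cat w η)

lemma Admissible.comp {h α : Cantor → Cantor} (hh : Admissible D h) (hα : QuasiRepl D α) :
    QuasiRepl D fun η => h (α η) := by
  obtain ⟨k, hk, hα⟩ := hα
  suffices ∀ β, PrefixRepl β → QuasiRepl D fun η => h (β η) by
    simpa using (this _ hα).comp_mem (inv_mem hk)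
  intro β hβ
  induction hβ with
  | base β w hβ => simpa [hβ] using hh w
  | node β _ _ ihl ihr => exact .node ihl ihr

lemma Admissible.consHom {h : Cantor ≃ₜ Cantor} (hh : Admissible D h) (b : Bool) :
    Admissible D (consHom b h) := by
  have key : ∀ (a : Bool) (w : List Bool),
      QuasiRepl D fun η => LodhaMoore.consHom b h (cat (a :: w) η) := by
    intro a w
    by_cases hab : a = b
    · simpa [hab] using (hh w).cons_comp b
    · simpa [hab] using quasiRepl_cat (D := D) (a :: w)
  rintro (_ | ⟨a, w⟩)
  · exact .node (by simpa using key false []) (by simpa using key true [])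
  · exact key a w

lemma Admissible.lift {h : Cantor ≃ₜ Cantor} (hh : Admissible D h) (s : List Bool) :
    Admissible D (lift s h) := by
  induction s with
  | nil => exact hh
  | cons b s ih => exact ih.consHom b

variable (D)

lemma admissible_x : Admissible D D.x := by
  have h00 (w) : QuasiRepl D fun η => D.x (cat (false :: false :: w) η) := by
    simpa [x_zero_zero] using quasiRepl_cat (false :: w)
  have h01 (w) : QuasiRepl D fun η => D.x (cat (false :: true :: w) η) := by
    simpa [x_zero_one] using quasiRepl_cat (true :: false :: w)
  have h1 (w) : QuasiRepl D fun η => D.x (cat (true :: w) η) := by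
    simpa [x_one] using quasiRepl_cat (true :: true :: w)
  rintro (_ | ⟨_ | _, _ | ⟨_ | _, w⟩⟩)
  · simpa using quasiRepl_of_mem (x_mem_lmgrp D)
  · exact .node (by simpa using h00 []) (by simpa using h01 [])
  exacts [h00 w, h01 w, h1 _, h1 _, h1 _]

lemma admissible_x_symm : Admissible D D.x.symm := by
  have h0 (w) : QuasiRepl D fun η => D.x.symm (cat (false :: w) η) := by
    simpa [x_symm_zero] using quasiRepl_cat (false :: false :: w)
  have h10 (w) : QuasiRepl D fun η => D.x.symm (cat (true :: false :: w) η) := by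
    simpa [x_symm_one_zero] using quasiRepl_cat (false :: true :: w)
  have h11 (w) : QuasiRepl D fun η => D.x.symm (cat (true :: true :: w) η) := by
    simpa [x_symm_one_one] using quasiRepl_cat (true :: w)
  rintro (_ | ⟨_ | _, _ | ⟨_ | _, w⟩⟩)
  · simp only [cat_nil]
    exact quasiRepl_of_mem (h := D.x⁻¹) (inv_mem (x_mem_lmgrp D))
  · exact h0 _
  · exact h0 _
  · exact h0 _
  · exact .node (by simpa using h10 []) (by simpa using h11 [])
  exacts [h10 w, h11 w]

lemma quasiRepl_y_cat (n : ℕ) : ∀ w : List Bool, w.length ≤ n →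
    QuasiRepl D (fun η => D.y (cat w η)) ∧ QuasiRepl D (fun η => D.y.symm (cat w η)) := by
  have hy : QuasiRepl D D.y := quasiRepl_of_mem (y_mem_lmgrp D)
  have hy' : QuasiRepl D D.y.symm := quasiRepl_of_mem (inv_mem (y_mem_lmgrp D))
  induction n with
  | zero =>
    intro w hw
    obtain rfl : w = [] := List.length_eq_zero_iff.1 (Nat.le_zero.1 hw)
    simpa using ⟨hy, hy'⟩
  | succ n ih =>
    rintro (_ | ⟨_ | _, w⟩) hw
    · simpa using ⟨hy, hy'⟩
    · refine ⟨?_, by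
        simpa [y_symm_zero] using ((ih w (by simpa using hw)).2.cons_comp false).cons_comp false⟩
      rcases w with _ | ⟨_ | _, w⟩
      · exact .node (by simpa [y_zero_zero] using hy.cons_comp false)
          (by simpa [y_zero_one] using (hy'.cons_comp false).cons_comp true)
      · simpa [y_zero_zero] using (ih w (by simp at hw; omega)).1.cons_comp false
      · simpa [y_zero_one] using
          ((ih w (by simp at hw; omega)).2.cons_comp false).cons_comp true
    · refine ⟨by
        simpa [y_one] using ((ih w (by simpa using hw)).1.cons_comp true).cons_comp true, ?_⟩
      rcases w with _ | ⟨_ | _, w⟩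
      · exact .node (by simpa [y_symm_one_zero] using (hy.cons_comp true).cons_comp false)
          (by simpa [y_symm_one_one] using hy'.cons_comp true)
      · simpa [y_symm_one_zero] using
          ((ih w (by simp at hw; omega)).1.cons_comp true).cons_comp false
      · simpa [y_symm_one_one] using (ih w (by simp at hw; omega)).2.cons_comp true

lemma admissible_y : Admissible D D.y := fun w => (quasiRepl_y_cat D _ w le_rfl).1

lemma admissible_y_symm : Admissible D D.y.symm := fun w => (quasiRepl_y_cat D _ w le_rfl).2

lemma admissible_p_zero : Admissible D (D.p 0) := by
  have key (a w) : QuasiRepl D fun η => D.p 0 (cat (a :: w) η) := by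
    simpa [p_zero_cons] using quasiRepl_cat ((!a) :: w)
  rintro (_ | ⟨a, w⟩)
  · exact .node (by simpa using key false []) (by simpa using key true [])
  · exact key a w

lemma p_zero_symm : (D.p 0).symm = D.p 0 := by
  refine Homeomorph.ext fun ξ => ?_
  obtain ⟨b, η, rfl⟩ := exists_eq_cons ξ
  rw [p_zero_symm_cons, p_zero_cons]

/-- The homeomorphisms `g` such that left composition with `g` and `g⁻¹` preserves the prefix
replacements up to the Lodha–Moore group. -/
def quasiSubgroup : Subgroup (Cantor ≃ₜ Cantor) where
  carrier := {g | ∀ α, QuasiRepl D α →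
    QuasiRepl D (fun η => g (α η)) ∧ QuasiRepl D (fun η => g.symm (α η))}
  one_mem' := fun _ h => ⟨h, h⟩
  mul_mem' := fun hf hg α h => ⟨(hf _ (hg α h).1).1, (hg _ (hf α h).2).2⟩
  inv_mem' := fun hg α h => (hg α h).symm

lemma shat_le_quasiSubgroup : Shat D ≤ quasiSubgroup D := by
  have key {g : Cantor ≃ₜ Cantor} (h : Admissible D g) (h' : Admissible D g.symm)
      (s : List Bool) : lift s g ∈ quasiSubgroup D := by
    intro α hα
    refine ⟨(h.lift s).comp hα, ?_⟩
    change QuasiRepl D fun η => (lift s g)⁻¹ (α η)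
    rw [← map_inv]
    exact (Admissible.lift (h := g⁻¹) h' s).comp hα
  refine shat_le D (fun s => ?_) (fun s => ?_) ?_
  · exact xx_eq_lift D s ▸ key (admissible_x D) (admissible_x_symm D) s
  · exact yy_eq_lift D s ▸ key (admissible_y D) (admissible_y_symm D) s
  · exact key (admissible_p_zero D) (p_zero_symm D ▸ admissible_p_zero D) []

end Quasi

/-! ### The rigid stabilizer -/

lemma exists_eq_lift {s : List Bool} {g : Cantor ≃ₜ Cantor}
    (hg : ∀ ξ, ¬ IsPrefixOf s ξ → g ξ = ξ) : ∃ h : Cantor ≃ₜ Cantor, g = lift s h := by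
  induction s generalizing g with
  | nil => exact ⟨g, rfl⟩
  | cons b s ih =>
    have hfix (ξ) (h : ξ 0 ≠ b) : g ξ = ξ := hg ξ <| by
      rw [← cons_tail ξ, isPrefixOf_cons]
      exact fun h' => h h'.1
    have hmap (η) : g (cons b η) 0 = b := by
      by_contra h
      have := g.injective (hfix _ h)
      rw [this] at h
      exact h rfl
    have hmap' (η) : g.symm (cons b η) 0 = b := by
      by_contra h
      have := hfix _ h
      rw [g.apply_symm_apply] at this
      rw [← this] at h
      exact h rfl
    have hcons (η) : cons b (tail (g (cons b η))) = g (cons b η) := by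
      simpa only [hmap] using cons_tail (g (cons b η))
    have hcons' (η) : cons b (tail (g.symm (cons b η))) = g.symm (cons b η) := by
      simpa only [hmap'] using cons_tail (g.symm (cons b η))
    let h : Cantor ≃ₜ Cantor :=
      { toFun := fun η => tail (g (cons b η))
        invFun := fun η => tail (g.symm (cons b η))
        left_inv := fun η => by simp [hcons]
        right_inv := fun η => by simp [hcons']
        continuous_toFun := continuous_tail.comp (g.continuous.comp (continuous_cons b))
        continuous_invFun := continuous_tail.comp (g.symm.continuous.comp (continuous_cons b)) }
    obtain ⟨h', hh'⟩ := ih (g := h) fun ξ hξ => by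
      change tail (g (cons b ξ)) = ξ
      rw [hg _ fun hp => hξ (isPrefixOf_cons.1 hp).2, tail_cons]
    refine ⟨h', ?_⟩
    rw [lift_cons, ← hh']
    refine Homeomorph.ext fun ξ => ?_
    obtain ⟨a, η, rfl⟩ := exists_eq_cons ξ
    by_cases hab : a = b
    · subst hab
      rw [consHom_apply_cons, if_pos rfl]
      exact (hcons η).symm
    · simpa [hab] using hfix (cons a η) hab

variable (D : LMData)

lemma rStabU_le : RStabU D ≤ (LMgrp D).map (lift [true, false]) := by
  rintro g ⟨hg, hfix⟩
  obtain ⟨h, rfl⟩ := exists_eq_lift (s := [true, false]) (g := g) hfix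
  refine ⟨h, ?_, rfl⟩
  have hord : h ∈ orderSubgroup := by
    intro a b
    have := shat_le_cycSubgroup D hg (cons true (cons false a)) (cons true (cons false b))
      (cons true (cons true fun _ => true))
    simpa [Cyc] using this
  obtain ⟨k, hk, hrepl⟩ :=
    (shat_le_quasiSubgroup D hg _ (quasiRepl_cat [true, false])).1
  have hrepl' : PrefixRepl (h * k : Cantor ≃ₜ Cantor) := by
    simp only [lift_cat] at hrepl
    simp only [cat_cons, cat_nil] at hrepl
    exact hrepl.of_cons_comp.of_cons_comp
  have := mem_lmgrp_of_prefixRepl D (mul_mem hord (lmgrp_le_orderSubgroup D hk)) hrepl'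
  exact ((LMgrp D).mul_mem_cancel_right hk).1 this

lemma map_lift_le (s : List Bool) : (LMgrp D).map (lift s) ≤ Shat D := by
  rw [Subgroup.map_le_iff_le_comap]
  refine lmgrp_le D (fun t => ?_) fun t => ?_
  · rw [Subgroup.mem_comap, xx_eq_lift, ← lift_append, ← xx_eq_lift]
    exact Subgroup.subset_closure (Or.inl (Or.inl ⟨_, rfl⟩))
  · rw [Subgroup.mem_comap, yy_eq_lift, ← lift_append, ← yy_eq_lift]
    exact Subgroup.subset_closure (Or.inl (Or.inr ⟨_, rfl⟩))

lemma rStabU_eq_map : RStabU D = (LMgrp D).map (lift [true, false]) := by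
  refine le_antisymm (rStabU_le D) fun g hg => ⟨map_lift_le D _ hg, ?_⟩
  obtain ⟨h, -, rfl⟩ := hg
  exact fun ξ hξ => lift_of_not_isPrefixOf _ h ξ hξ

lemma map_lift_lmgrp (s : List Bool) : (LMgrp D).map (lift s) =
    Subgroup.closure ((Set.range fun t => D.xx (s ++ t)) ∪ Set.range fun t => D.yy (s ++ t)) := by
  rw [LMgrp, MonoidHom.map_closure, Set.image_union, ← Set.range_comp, ← Set.range_comp]
  congr 3
  · funext t
    simp [xx_eq_lift, lift_append]
  · funext t
    simp [yy_eq_lift, lift_append]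

end LodhaMoore

open LodhaMoore

/-- the rigid stabilizer of `U` in `Ŝ` is the subgroup generated by the
`x_{10s}` and `y_{10s}`, and it is isomorphic to `_yG_y` via `x_{10s} ↦ x_s`,
`y_{10s} ↦ y_s`. -/
theorem statement10 (D : LMData) :
    RStabU D =
      Subgroup.closure ((Set.range fun s => D.xx ([true, false] ++ s)) ∪
        (Set.range fun s => D.yy ([true, false] ++ s))) ∧
    ∃ e : ↥(RStabU D) ≃* ↥(LMgrp D),
      (∀ (s : List Bool) (h : D.xx ([true, false] ++ s) ∈ RStabU D),
        ((e ⟨D.xx ([true, false] ++ s), h⟩ : ↥(LMgrp D)) : Cantor ≃ₜ Cantor) = D.xx s) ∧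
      (∀ (s : List Bool) (h : D.yy ([true, false] ++ s) ∈ RStabU D),
        ((e ⟨D.yy ([true, false] ++ s), h⟩ : ↥(LMgrp D)) : Cantor ≃ₜ Cantor) = D.yy s) := by
  refine ⟨(rStabU_eq_map D).trans (map_lift_lmgrp D _), ?_⟩
  let φ := (LMgrp D).equivMapOfInjective (lift [true, false]) (lift_injective _)
  refine ⟨(MulEquiv.subgroupCongr (rStabU_eq_map D)).trans φ.symm, fun s h => ?_, fun s h => ?_⟩
  · refine congrArg Subtype.val (φ.symm_apply_eq.2 ?_ : _ = ⟨D.xx s, xx_mem_lmgrp D s⟩)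
    exact Subtype.ext (by simp [φ, xx_eq_lift])
  · refine congrArg Subtype.val (φ.symm_apply_eq.2 ?_ : _ = ⟨D.yy s, yy_mem_lmgrp D s⟩)
    exact Subtype.ext (by simp [φ, yy_eq_lift])
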